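/- arXiv:1101.0792 — 5 statements merged into one kernel-verified Lean document; each statement's English description precedes it below -/
import Mathlib

section
/- Let (X, d) be a metric space and let (x_n) be a sequence in X such that K := closure of {x_n : n ∈ ℕ} is compact. Let m ∈ ℕ, let c_1, ..., c_m be points of X and let r_1, ..., r_m be rational numbers. Then K ⊆ ⋃_{i=1}^{m} B(c_i, r_i) if and only if there exists k ∈ ℕ such that for every n ∈ ℕ there exists i ∈ {1, ..., m} with d(x_n, c_i) ≤ r_i − 2^{-k}. -/
/-- Characterization of finite rational open covers of the compact closure of the range
of a sequence: the closure is covered by the balls `B(c i, r i)` iff for some `k` every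
member of the sequence is `2^{-k}`-deep inside one of the balls. -/
theorem cover_closure_range_iff {X : Type*} [MetricSpace X] (u : ℕ → X)
    (hK : IsCompact (closure (Set.range u))) (m : ℕ) (c : Fin m → X) (r : Fin m → ℚ) :
    closure (Set.range u) ⊆ ⋃ i : Fin m, Metric.ball (c i) ((r i : ℝ)) ↔
      ∃ k : ℕ, ∀ n : ℕ, ∃ i : Fin m, dist (u n) (c i) ≤ (r i : ℝ) - (2 : ℝ) ^ (-(k : ℤ)) := by
  constructor
  · intro h
    have hpos : ∀ k : ℕ, (2 : ℝ) ^ (-(k : ℤ)) = (1 / 2 : ℝ) ^ k := by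
      intro k
      rw [zpow_neg, zpow_natCast, one_div, inv_pow]
    obtain ⟨k, hk⟩ := hK.elim_directed_cover
      (fun k : ℕ => ⋃ i : Fin m, Metric.ball (c i) ((r i : ℝ) - (1 / 2 : ℝ) ^ k))
      (fun k => isOpen_iUnion fun i => Metric.isOpen_ball)
      (by
        intro x hx
        obtain ⟨i, hi⟩ := Set.mem_iUnion.1 (h hx)
        rw [Metric.mem_ball] at hi
        obtain ⟨k, hk⟩ := exists_pow_lt_of_lt_one (sub_pos.2 hi) (by norm_num : (1 / 2 : ℝ) < 1)
        refine Set.mem_iUnion.2 ⟨k, Set.mem_iUnion.2 ⟨i, ?_⟩⟩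
        rw [Metric.mem_ball]
        linarith)
      (by
        apply Monotone.directed_le
        intro a b hab
        refine Set.iUnion_mono fun i => Metric.ball_subset_ball ?_
        have := pow_le_pow_of_le_one (by norm_num : (0 : ℝ) ≤ 1 / 2) (by norm_num) hab
        linarith)
    refine ⟨k, fun n => ?_⟩
    obtain ⟨i, hi⟩ := Set.mem_iUnion.1 (hk (subset_closure (Set.mem_range_self n)))
    rw [Metric.mem_ball] at hi
    exact ⟨i, by rw [hpos]; exact hi.le⟩
  · rintro ⟨k, hk⟩
    have hc : IsClosed (⋃ i : Fin m, Metric.closedBall (c i) ((r i : ℝ) - (2 : ℝ) ^ (-(k : ℤ)))) :=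
      isClosed_iUnion_of_finite fun i => Metric.isClosed_closedBall
    have h1 := closure_minimal (s := Set.range u) (by
      rintro _ ⟨n, rfl⟩
      obtain ⟨i, hi⟩ := hk n
      exact Set.mem_iUnion.2 ⟨i, hi⟩) hc
    refine h1.trans (Set.iUnion_mono fun i => Metric.closedBall_subset_ball ?_)
    have : (0 : ℝ) < (2 : ℝ) ^ (-(k : ℤ)) := by positivity
    linarith
end

section
/- Let (X, d) be a metric space and let (x_n) be a sequence in X. Consider the set A := {(x_n, 2^{-n}) : n ∈ ℕ} ⊆ X × ℝ (with the product metric/topology). Then the set of accumulation points of A is exactly {(x, 0) : x is a cluster point of (x_n)}. -/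
/-- `x` is a cluster point of the sequence `u`: every neighborhood of `x`
contains `u n` for infinitely many `n`. -/
def IsClusterPointOf {X : Type*} [TopologicalSpace X] (x : X) (u : ℕ → X) : Prop :=
  ∀ U ∈ nhds x, ∀ k : ℕ, ∃ n ≥ k, u n ∈ U

/-- `p` is an accumulation point of the set `A`: every neighborhood of `p`
meets `A \ {p}`. -/
def IsAccPointOf {Y : Type*} [TopologicalSpace Y] (p : Y) (A : Set Y) : Prop :=
  ∀ U ∈ nhds p, (U ∩ (A \ {p})).Nonempty

/-- The accumulation points of `A = {(x_n, 2^{-n}) : n ∈ ℕ} ⊆ X × ℝ` are exactly the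
points `(x, 0)` where `x` is a cluster point of the sequence `(x_n)`. -/
theorem accPoints_of_graph_eq_clusterPoints {X : Type*} [MetricSpace X] (u : ℕ → X) :
    {p : X × ℝ | IsAccPointOf p {q : X × ℝ | ∃ n : ℕ, q = (u n, (2 : ℝ) ^ (-(n : ℤ)))}} =
      {p : X × ℝ | ∃ x : X, IsClusterPointOf x u ∧ p = (x, 0)} := by
  have hlim : Filter.Tendsto (fun n : ℕ => (2 : ℝ) ^ (-(n : ℤ))) Filter.atTop (nhds 0) := by
    have h := tendsto_pow_atTop_nhds_zero_of_lt_one (r := (1 / 2 : ℝ)) (by norm_num) (by norm_num)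
    refine h.congr fun n => ?_
    simp [zpow_neg]
  ext p
  simp only [Set.mem_setOf_eq]
  constructor
  · intro hp
    have key : ∀ U ∈ nhds p, ∀ k : ℕ, ∃ n ≥ k, (u n, (2 : ℝ) ^ (-(n : ℤ))) ∈ U := by
      intro U hU k
      have hfin : (((fun n : ℕ => (u n, (2 : ℝ) ^ (-(n : ℤ)))) '' Set.Iio k) \ {p}).Finite :=
        ((Set.finite_Iio k).image _).subset Set.diff_subset
      have hV := hfin.isClosed.isOpen_compl.mem_nhds (x := p) (by simp)
      obtain ⟨q, ⟨hqU, hqV⟩, ⟨n, rfl⟩, hne⟩ := hp _ (Filter.inter_mem hU hV)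
      refine ⟨n, ?_, hqU⟩
      by_contra hlt
      exact hqV ⟨⟨n, not_le.mp hlt, rfl⟩, hne⟩
    obtain ⟨x, t⟩ := p
    have ht : t = 0 := by
      by_contra hne
      obtain ⟨V, W, hV, hW, htV, h0W, hd⟩ := t2_separation hne
      obtain ⟨k, hk⟩ := Filter.eventually_atTop.mp (hlim (hW.mem_nhds h0W))
      obtain ⟨n, hn, hm⟩ := key (Set.univ ×ˢ V)
        (prod_mem_nhds Filter.univ_mem (hV.mem_nhds htV)) k
      exact Set.disjoint_left.mp hd hm.2 (hk n hn)
    subst ht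
    refine ⟨x, fun U hU k => ?_, rfl⟩
    obtain ⟨n, hn, hm⟩ := key (U ×ˢ Set.univ) (prod_mem_nhds hU Filter.univ_mem) k
    exact ⟨n, hn, hm.1⟩
  · rintro ⟨x, hx, rfl⟩ U hU
    obtain ⟨V, hV, W, hW, hVW⟩ := mem_nhds_prod_iff.mp hU
    obtain ⟨k, hk⟩ := Filter.eventually_atTop.mp (hlim hW)
    obtain ⟨n, hn, hm⟩ := hx V hV k
    refine ⟨(u n, (2 : ℝ) ^ (-(n : ℤ))), hVW ⟨hm, hk n hn⟩, ⟨n, rfl⟩, ?_⟩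
    intro h
    have h2 : (2 : ℝ) ^ (-(n : ℤ)) = 0 := congrArg Prod.snd h
    have h3 : (0 : ℝ) < (2 : ℝ) ^ (-(n : ℤ)) := by positivity
    exact h3.ne' h2
end

section
/- Let (x_n) be a sequence of real numbers. Suppose that (x_n) is eventually bounded away from each point of [0,1]; that is, for every x ∈ [0,1] there exist N ∈ ℕ and δ > 0 such that |x_n − x| > δ for all n ≥ N. Then (x_n) is eventually uniformly bounded away from [0,1]: there exist N ∈ ℕ and k ∈ ℕ such that |x_n − x| > 2^{-k} for all x ∈ [0,1] and all n ≥ N. -/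
/-- Classical content of the antithesis of Specker's Theorem: a sequence of reals that is
eventually bounded away from each point of `[0,1]` is eventually uniformly bounded
away from the set `[0,1]`. -/
theorem eventually_bounded_away_uniform (x : ℕ → ℝ)
    (h : ∀ t ∈ Set.Icc (0 : ℝ) 1, ∃ N : ℕ, ∃ δ : ℝ, 0 < δ ∧ ∀ n ≥ N, |x n - t| > δ) :
    ∃ N : ℕ, ∃ k : ℕ, ∀ t ∈ Set.Icc (0 : ℝ) 1, ∀ n ≥ N, |x n - t| > (2 : ℝ) ^ (-(k : ℤ)) := by
  have key : ∃ N : ℕ, ∃ δ : ℝ, 0 < δ ∧ ∀ t ∈ Set.Icc (0 : ℝ) 1, ∀ n ≥ N, |x n - t| > δ := by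
    refine isCompact_Icc.induction_on
      (p := fun s : Set ℝ => ∃ N : ℕ, ∃ δ : ℝ, 0 < δ ∧ ∀ t ∈ s, ∀ n ≥ N, |x n - t| > δ)
      ?_ ?_ ?_ ?_
    · exact ⟨0, 1, one_pos, fun t ht => absurd ht (Set.notMem_empty t)⟩
    · rintro s u hsu ⟨N, δ, hδ, H⟩
      exact ⟨N, δ, hδ, fun t ht => H t (hsu ht)⟩
    · rintro s u ⟨N, δ, hδ, H⟩ ⟨M, ε, hε, K⟩
      refine ⟨max N M, min δ ε, lt_min hδ hε, ?_⟩
      rintro t (ht | ht) n hn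
      · exact lt_of_le_of_lt (min_le_left _ _) (H t ht n (le_trans (le_max_left _ _) hn))
      · exact lt_of_le_of_lt (min_le_right _ _) (K t ht n (le_trans (le_max_right _ _) hn))
    · intro t ht
      obtain ⟨N, δ, hδ, H⟩ := h t ht
      refine ⟨Metric.ball t (δ / 2), mem_nhdsWithin_of_mem_nhds
        (Metric.ball_mem_nhds t (half_pos hδ)), N, δ / 2, half_pos hδ, ?_⟩
      intro u hu n hn
      have h1 := H n hn
      rw [Metric.mem_ball, Real.dist_eq] at hu
      have h2 := abs_sub_le (x n) u t
      linarith
  obtain ⟨N, δ, hδ, H⟩ := key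
  obtain ⟨k, hk⟩ := exists_pow_lt_of_lt_one hδ (by norm_num : (1 / 2 : ℝ) < 1)
  refine ⟨N, k, fun t ht n hn => lt_trans ?_ (H t ht n hn)⟩
  rw [zpow_neg, zpow_natCast, ← inv_pow]
  simpa using hk
end

section
/- Let D be a nonempty compact subset of Baire space ℕ^ℕ and let K : ℕ^ℕ → ℕ^ℕ be a function that is continuous on D and such that for every p ∈ D the sequence K(p) is bounded, i.e., there exists m ∈ ℕ with K(p)(k) ≤ m for all k ∈ ℕ. Then there exist m ∈ ℕ and a nonempty set A ⊆ D that is clopen in the subspace topology of D, such that K(p)(k) ≤ m for all p ∈ A and all k ∈ ℕ. -/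
/-- If `K` is continuous on a nonempty compact set `D ⊆ ℕ^ℕ` (Baire space, with the
product of the discrete topologies) and `K p` is a bounded sequence for each `p ∈ D`,
then there is a uniform bound `m` valid on some nonempty subset `A ⊆ D` that is clopen
in the subspace topology of `D`. -/
theorem uniform_bound_on_clopen_subset (D : Set (ℕ → ℕ)) (hD : D.Nonempty)
    (hDc : IsCompact D) (K : (ℕ → ℕ) → (ℕ → ℕ)) (hK : ContinuousOn K D)
    (hb : ∀ p ∈ D, ∃ m : ℕ, ∀ k : ℕ, K p k ≤ m) :
    ∃ (m : ℕ) (A : Set (ℕ → ℕ)), A.Nonempty ∧ A ⊆ D ∧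
      IsClopen (Subtype.val ⁻¹' A : Set D) ∧ ∀ p ∈ A, ∀ k : ℕ, K p k ≤ m := by
  haveI : CompactSpace D := isCompact_iff_compactSpace.mp hDc
  haveI : Nonempty D := hD.to_subtype
  have hK' : Continuous (fun p : D => K p) := continuousOn_iff_continuous_restrict.mp hK
  obtain ⟨m, x, hx⟩ := nonempty_interior_of_iUnion_of_closed
    (f := fun m : ℕ => {p : D | ∀ k, K p k ≤ m})
    (fun m => by
      simp only [Set.setOf_forall]
      exact isClosed_iInter fun k =>
        isClosed_le ((continuous_apply k).comp hK') continuous_const)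
    (by
      ext p
      simpa using hb p p.2)
  obtain ⟨V, hV, hxV, hVU⟩ := compact_exists_isClopen_in_isOpen isOpen_interior hx
  refine ⟨m, Subtype.val '' V, ⟨x, x, hxV, rfl⟩, ?_, ?_, ?_⟩
  · rintro _ ⟨y, _, rfl⟩
    exact y.2
  · rwa [Set.preimage_image_eq _ Subtype.val_injective]
  · rintro _ ⟨y, hy, rfl⟩
    exact interior_subset (hVU hy)
end

section
/- Let f : ⊆ X ⇉ Y and g : ⊆ Z ⇉ W be partial multi-valued functions between represented spaces (X, δ_X), (Y, δ_Y), (Z, δ_Z), (W, δ_W), and let H, K : ⊆ ℕ^ℕ → ℕ^ℕ be arbitrary partial functions. Then the following are equivalent: (1) H ∘ G ∘ lim ∘ K is a realizer of f for every realizer G of g; (2) H ∘ F ∘ K is a realizer of f for every realizer F of g', where g' is the jump of g. -/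
/-- Baire space `ℕ^ℕ`. -/
abbrev Baire : Type := ℕ → ℕ

/-- `F` is a realizer of the partial multi-valued function `f : ⊆ X ⇉ Y`
(given as `f : X → Set Y` with `dom f = {x | (f x).Nonempty}`) with respect to the
representations `δX` and `δY` (partial functions from Baire space): for every name `p`
of a point `x ∈ dom f`, `F p` is defined and is a `δY`-name of some element of `f x`. -/
def Realizes {X Y : Type} (δX : Baire →. X) (δY : Baire →. Y)
    (F : Baire →. Baire) (f : X → Set Y) : Prop :=
  ∀ (p : Baire) (x : X), x ∈ δX p → (f x).Nonempty →
    ∃ q ∈ F p, ∃ y ∈ δY q, y ∈ f x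

/-- The partial limit map `lim : ⊆ ℕ^ℕ → ℕ^ℕ`: on input `q` coding the sequence of
sequences `p_i = fun k => q (Nat.pair i k)`, it is defined iff each coordinate sequence
`i ↦ q (Nat.pair i k)` is eventually constant, and then outputs the pointwise limit. -/
noncomputable def limPFun : Baire →. Baire := fun q =>
  ⟨∀ k : ℕ, ∃ N : ℕ, ∀ i ≥ N, q (Nat.pair i k) = q (Nat.pair N k),
   fun h k => q (Nat.pair (Classical.choose (h k)) k)⟩

/-- Jump Realization Lemma: for partial multi-valued functions `f : ⊆ X ⇉ Y` and
`g : ⊆ Z ⇉ W` on represented spaces and arbitrary partial functions `H, K` on Baire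
space, `H ∘ G ∘ lim ∘ K` realizes `f` for every realizer `G` of `g` iff `H ∘ F ∘ K`
realizes `f` for every realizer `F` of the jump `g'` (which is `g` with the jumped
input representation `δZ' = δZ ∘ lim`). -/
theorem jump_realization {X Y Z W : Type}
    (δX : Baire →. X) (δY : Baire →. Y) (δZ : Baire →. Z) (δW : Baire →. W)
    (hX : δX.ran = Set.univ) (hY : δY.ran = Set.univ)
    (hZ : δZ.ran = Set.univ) (hW : δW.ran = Set.univ)
    (f : X → Set Y) (g : Z → Set W) (H K : Baire →. Baire) :
    (∀ G : Baire →. Baire, Realizes δZ δW G g →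
        Realizes δX δY (H.comp (G.comp (limPFun.comp K))) f) ↔
    (∀ F : Baire →. Baire, Realizes (δZ.comp limPFun) δW F g →
        Realizes δX δY (H.comp (F.comp K)) f) := by
  classical
  have mc : ∀ {A B C : Type} (u : B →. C) (v : A →. B) (a : A) (c : C),
      c ∈ (u.comp v) a ↔ ∃ b ∈ v a, c ∈ u b := by
    intro A B C u v a c
    rw [PFun.comp_apply]
    exact Part.mem_bind_iff
  constructor
  · intro h F hF p x hx hne
    -- a realizer of g exists
    have hG0 : ∃ G0 : Baire →. Baire, Realizes δZ δW G0 g := by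
      have key : ∀ t : Baire, ∃ q : Baire, ∀ z ∈ δZ t, (g z).Nonempty →
          ∃ w ∈ δW q, w ∈ g z := by
        intro t
        by_cases ht : ∃ z ∈ δZ t, (g z).Nonempty
        · obtain ⟨z, hz, w, hw⟩ := ht
          have hr : w ∈ δW.ran := by rw [hW]; trivial
          obtain ⟨q, hq⟩ := hr
          refine ⟨q, fun z' hz' _ => ⟨w, hq, ?_⟩⟩
          rw [Part.mem_unique hz' hz]
          exact hw
        · exact ⟨fun _ => 0, fun z hz hg => absurd ⟨z, hz, hg⟩ ht⟩
      choose G0 hG0 using key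
      exact ⟨fun t => Part.some (G0 t), fun t z hz hg =>
        ⟨G0 t, Part.mem_some _, hG0 t z hz hg⟩⟩
    obtain ⟨G0, hG0⟩ := hG0
    obtain ⟨q0, hq0, -⟩ := h G0 hG0 p x hx hne
    simp only [mc] at hq0
    obtain ⟨_, ⟨s, ⟨r, hr, hs⟩, -⟩, -⟩ := hq0
    have hG : Realizes δZ δW (fun t => if t = s then F r else G0 t) g := by
      intro t z hz hg
      by_cases ht : t = s
      · subst ht
        simp only [if_true]
        exact hF r z ((mc _ _ _ _).2 ⟨t, hs, hz⟩) hg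
      · simp only [if_neg ht]
        exact hG0 t z hz hg
    obtain ⟨q, hq, hy⟩ := h _ hG p x hx hne
    refine ⟨q, ?_, hy⟩
    obtain ⟨b, hb1, hqb⟩ := (mc _ _ _ _).1 hq
    obtain ⟨s', hs1, hb⟩ := (mc _ _ _ _).1 hb1
    obtain ⟨r', hr', hs'⟩ := (mc _ _ _ _).1 hs1
    obtain rfl := Part.mem_unique hr' hr
    obtain rfl := Part.mem_unique hs' hs
    simp only [if_true] at hb
    exact (mc _ _ _ _).2 ⟨b, (mc _ _ _ _).2 ⟨r', hr, hb⟩, hqb⟩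
  · intro h G hG
    have hF : Realizes (δZ.comp limPFun) δW (G.comp limPFun) g := by
      intro p z hz hg
      obtain ⟨s, hs, hz⟩ := (mc _ _ _ _).1 hz
      obtain ⟨q, hq, hy⟩ := hG s z hz hg
      exact ⟨q, (mc _ _ _ _).2 ⟨s, hs, hq⟩, hy⟩
    have := h _ hF
    rwa [PFun.comp_assoc] at this
end
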